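/- Let G be an abelian group, F a field, and A, B G-graded algebras over F. Then for nonzero x, y in Z_{\geq 0}G, there is an isomorphism of G-graded algebras M_x(A) \otimes M_y(B) \cong M_{xy}(A \otimes B), where the tensor product of G-graded algebras is graded by deg(a \otimes b) = (deg a)(deg b) on homogeneous elements. -/

import Mathlib

noncomputable section

open scoped TensorProduct

/-- A `G`-grading on the `F`-algebra `A`: the components multiply according to the group law,
`1` is homogeneous of trivial degree, and `A` is the internal direct sum of the components. -/
def IsGrading (F : Type) [Field F] {G : Type} [CommGroup G] [DecidableEq G]
    {A : Type} [Ring A] [Algebra F A] (𝒜 : G → Submodule F A) : Prop :=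
  (1 : A) ∈ 𝒜 1 ∧
  (∀ {g h : G} {a b : A}, a ∈ 𝒜 g → b ∈ 𝒜 h → a * b ∈ 𝒜 (g * h)) ∧
  DirectSum.IsInternal 𝒜

/-- Isomorphism of `G`-graded algebras: an algebra isomorphism matching up the
homogeneous components. -/
def IsGradedAlgIso (F : Type) [Field F] {G : Type} [CommGroup G]
    {A B : Type} [Ring A] [Algebra F A] [Ring B] [Algebra F B]
    (𝒜 : G → Submodule F A) (ℬ : G → Submodule F B) : Prop :=
  ∃ e : A ≃ₐ[F] B, ∀ g, (𝒜 g).map e.toLinearMap = ℬ g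

/-- A homomorphism of graded algebras: it maps each component into the corresponding one. -/
def IsGradedHom (F : Type) [Field F] {G : Type} [CommGroup G]
    {A B : Type} [Ring A] [Algebra F A] [Ring B] [Algebra F B]
    (𝒜 : G → Submodule F A) (ℬ : G → Submodule F B) (f : A →ₐ[F] B) : Prop :=
  ∀ g, (𝒜 g).map f.toLinearMap ≤ ℬ g

/-- The `G`-grading on the matrix algebra `M_ι(A)` induced by a tuple `γ : ι → G` and the
grading `𝒜` of `A`: `deg (E i j a) = γ i * deg a * (γ j)⁻¹`. -/
def matrixGrading {F : Type} [Field F] {G : Type} [CommGroup G]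
    {A : Type} [Ring A] [Algebra F A] {ι : Type} (γ : ι → G)
    (𝒜 : G → Submodule F A) (g : G) : Submodule F (Matrix ι ι A) where
  carrier := {M | ∀ i j, M i j ∈ 𝒜 ((γ i)⁻¹ * g * γ j)}
  add_mem' := fun hM hN i j => add_mem (hM i j) (hN i j)
  zero_mem' := fun i j => zero_mem _
  smul_mem' := fun c M hM i j => Submodule.smul_mem _ c (hM i j)

/-- The trivial grading on the base field. -/
def trivGrading (F : Type) [Field F] (G : Type) [CommGroup G] [DecidableEq G]
    (g : G) : Submodule F F :=
  if g = 1 then ⊤ else ⊥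

/-- The elementary grading on a matrix algebra over `F` determined by the tuple `γ`. -/
def elemGrading {F : Type} [Field F] {G : Type} [CommGroup G] [DecidableEq G]
    {ι : Type} (γ : ι → G) : G → Submodule F (Matrix ι ι F) :=
  matrixGrading γ (trivGrading F G)

/-- `γ` is a tuple representing the multiset `x` of elements of `G`. -/
def Reps {G : Type} [CommGroup G] {n : ℕ} (γ : Fin n → G) (x : Multiset G) : Prop :=
  Multiset.map γ Finset.univ.val = x

/-- Product of multisets of group elements, corresponding to the product in the
group semiring `ℤ≥0 G`. -/
def mmul {G : Type} [CommGroup G] (x y : Multiset G) : Multiset G :=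
  x.bind fun g => y.map (g * ·)

/-- The image of a multiset under `g ↦ g⁻¹`, corresponding to the bar involution of `ℤG`. -/
def mbarM {G : Type} [CommGroup G] (x : Multiset G) : Multiset G :=
  x.map fun g => g⁻¹

/-- The grading of a tensor product of graded algebras: `deg (a ⊗ b) = deg a * deg b`. -/
def tensorGrading (F : Type) [Field F] {G : Type} [CommGroup G]
    {A B : Type} [Ring A] [Algebra F A] [Ring B] [Algebra F B]
    (𝒜 : G → Submodule F A) (ℬ : G → Submodule F B) (g : G) : Submodule F (A ⊗[F] B) :=
  ⨆ p : {p : G × G // p.1 * p.2 = g},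
    Submodule.map₂ (TensorProduct.mk F A B) (𝒜 p.1.1) (ℬ p.1.2)

/-- The grading induced on a subalgebra (e.g. a centralizer) of a graded algebra. -/
def subGrading {F : Type} [Field F] {G : Type} [CommGroup G]
    {B : Type} [Ring B] [Algebra F B] (C : Subalgebra F B)
    (ℬ : G → Submodule F B) (g : G) : Submodule F C :=
  (ℬ g).comap C.val.toLinearMap

/-- The grading on the opposite algebra, with the same homogeneous components. -/
def opGrading {F : Type} [Field F] {G : Type} [CommGroup G]
    {A : Type} [Ring A] [Algebra F A] (𝒜 : G → Submodule F A) (g : G) : Submodule F Aᵐᵒᵖ :=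
  (𝒜 g).map (MulOpposite.opLinearEquiv F).toLinearMap

/-- The grading on `End_F(A)` induced by a grading of `A`: a map is homogeneous of degree `g`
if it maps `A_h` into `A_{g h}` for all `h`. -/
def endGrading {F : Type} [Field F] {G : Type} [CommGroup G]
    {A : Type} [Ring A] [Algebra F A] (𝒜 : G → Submodule F A) (g : G) :
    Submodule F (Module.End F A) where
  carrier := {f | ∀ h : G, ∀ a ∈ 𝒜 h, f a ∈ 𝒜 (g * h)}
  add_mem' := fun hf hf' h a ha => add_mem (hf h a ha) (hf' h a ha)
  zero_mem' := fun _ _ _ => zero_mem _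
  smul_mem' := fun c f hf h a ha => Submodule.smul_mem _ c (hf h a ha)

/-- Two families on finite types with the same multiset of values differ by a bijection. -/
theorem exists_equiv_of_map_univ_eq {α β γ : Type*} [Fintype α] [Fintype β] {f : α → γ}
    {g : β → γ} (h : Multiset.map f Finset.univ.val = Multiset.map g Finset.univ.val) :
    ∃ e : α ≃ β, ∀ a, g (e a) = f a := by
  classical
  have key : ∀ c, Nonempty ({a // f a = c} ≃ {b // g b = c}) := by
    intro c
    rw [← Fintype.card_eq, Fintype.card_subtype, Fintype.card_subtype]
    have := congrArg (Multiset.count c) h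
    simpa [Multiset.count_map, Finset.card_def, eq_comm] using this
  exact ⟨Equiv.ofFiberEquiv fun c => (key c).some, Equiv.ofFiberEquiv_map _⟩

theorem mmul_map_univ {G : Type} [CommGroup G] {ι κ : Type*} [Fintype ι] [Fintype κ]
    (γ : ι → G) (δ : κ → G) :
    mmul (Multiset.map γ Finset.univ.val) (Multiset.map δ Finset.univ.val) =
      Multiset.map (fun p : ι × κ => γ p.1 * δ p.2) Finset.univ.val := by
  rw [← Finset.univ_product_univ, Finset.product_val]
  simp [mmul, SProd.sprod, Multiset.product, Multiset.bind_map, Multiset.map_bind]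

theorem tmul_mem_tensorGrading {F : Type} [Field F] {G : Type} [CommGroup G]
    {A B : Type} [Ring A] [Algebra F A] [Ring B] [Algebra F B]
    {𝒜 : G → Submodule F A} {ℬ : G → Submodule F B} {p q g : G} (hg : p * q = g)
    {a : A} {b : B} (ha : a ∈ 𝒜 p) (hb : b ∈ ℬ q) :
    a ⊗ₜ[F] b ∈ tensorGrading F 𝒜 ℬ g :=
  Submodule.mem_iSup_of_mem (⟨(p, q), hg⟩ : {p : G × G // p.1 * p.2 = g})
    (Submodule.apply_mem_map₂ (TensorProduct.mk F A B) ha hb)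

theorem tensorGrading_le {F : Type} [Field F] {G : Type} [CommGroup G]
    {A B : Type} [Ring A] [Algebra F A] [Ring B] [Algebra F B]
    {𝒜 : G → Submodule F A} {ℬ : G → Submodule F B} {g : G} {S : Submodule F (A ⊗[F] B)}
    (h : ∀ p q, p * q = g → ∀ a ∈ 𝒜 p, ∀ b ∈ ℬ q, a ⊗ₜ[F] b ∈ S) :
    tensorGrading F 𝒜 ℬ g ≤ S :=
  iSup_le fun p => Submodule.map₂_le.2 fun a ha b hb => h _ _ p.2 a ha b hb

theorem single_mem_matrixGrading {F : Type} [Field F] {G : Type} [CommGroup G]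
    {A : Type} [Ring A] [Algebra F A] {ι : Type} [DecidableEq ι] {γ : ι → G}
    {𝒜 : G → Submodule F A} {g : G} {i j : ι} {a : A} (ha : a ∈ 𝒜 ((γ i)⁻¹ * g * γ j)) :
    Matrix.single i j a ∈ matrixGrading γ 𝒜 g := by
  intro i' j'
  by_cases h : i = i' ∧ j = j'
  · obtain ⟨rfl, rfl⟩ := h
    simpa using ha
  · simp [Matrix.single, h]

/-- `M_γ(A) ⊗ M_δ(B) ≅ M_{γδ}(A ⊗ B)` as graded algebras, for tuples indexed by finite types. -/
theorem map_kroneckerTMulAlgEquiv_tensorGrading {F : Type} [Field F] {G : Type} [CommGroup G]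
    {A B : Type} [Ring A] [Algebra F A] [Ring B] [Algebra F B]
    (𝒜 : G → Submodule F A) (ℬ : G → Submodule F B)
    {ι κ : Type} [Fintype ι] [DecidableEq ι] [Fintype κ] [DecidableEq κ]
    (γ : ι → G) (δ : κ → G) (g : G) :
    (tensorGrading F (matrixGrading γ 𝒜) (matrixGrading δ ℬ) g).map
        (Matrix.kroneckerTMulAlgEquiv ι κ F F A B).toLinearMap =
      matrixGrading (fun p : ι × κ => γ p.1 * δ p.2) (tensorGrading F 𝒜 ℬ) g := by
  apply le_antisymm
  · rw [Submodule.map_le_iff_le_comap]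
    refine tensorGrading_le fun p q hpq M hM N hN => ?_
    rintro ⟨i, i'⟩ ⟨j, j'⟩
    refine tmul_mem_tensorGrading ?_ (hM i j) (hN i' j')
    subst hpq
    simp only [mul_inv]
    ac_rfl
  · intro N hN
    rw [Matrix.matrix_eq_sum_single N]
    refine Submodule.sum_mem _ fun i _ => Submodule.sum_mem _ fun j _ => ?_
    have hle : tensorGrading F 𝒜 ℬ ((γ i.1 * δ i.2)⁻¹ * g * (γ j.1 * δ j.2)) ≤
        ((tensorGrading F (matrixGrading γ 𝒜) (matrixGrading δ ℬ) g).map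
          (Matrix.kroneckerTMulAlgEquiv ι κ F F A B).toLinearMap).comap
          (Matrix.singleLinearMap F i j) := by
      refine tensorGrading_le fun p q hpq a ha b hb => ?_
      refine ⟨Matrix.single i.1 j.1 a ⊗ₜ Matrix.single i.2 j.2 b,
        tmul_mem_tensorGrading (p := γ i.1 * p * (γ j.1)⁻¹) (q := δ i.2 * q * (δ j.2)⁻¹) ?_
          (single_mem_matrixGrading ?_) (single_mem_matrixGrading ?_), ?_⟩
      · calc γ i.1 * p * (γ j.1)⁻¹ * (δ i.2 * q * (δ j.2)⁻¹)
            = γ i.1 * δ i.2 * (p * q) * (γ j.1 * δ j.2)⁻¹ := by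
              rw [mul_inv]; ac_rfl
          _ = g := by rw [hpq]; group
      · simpa [mul_assoc] using ha
      · simpa [mul_assoc] using hb
      · exact Matrix.single_kroneckerTMul_single F i.1 j.1 i.2 j.2 a b
    exact hle (hN i j)

theorem map_reindexAlgEquiv_matrixGrading {F : Type} [Field F] {G : Type} [CommGroup G]
    {A : Type} [Ring A] [Algebra F A] (𝒜 : G → Submodule F A)
    {ι κ : Type} [Fintype ι] [DecidableEq ι] [Fintype κ] [DecidableEq κ] {γ : ι → G} {δ : κ → G}
    (e : ι ≃ κ) (he : ∀ i, δ (e i) = γ i) (g : G) :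
    (matrixGrading γ 𝒜 g).map (Matrix.reindexAlgEquiv F A e).toLinearMap =
      matrixGrading δ 𝒜 g := by
  have he' : ∀ k, γ (e.symm k) = δ k := fun k => by rw [← he, e.apply_symm_apply]
  ext N
  constructor
  · rintro ⟨M, hM, rfl⟩ i j
    have := hM (e.symm i) (e.symm j)
    rwa [he', he'] at this
  · intro hN
    refine ⟨(Matrix.reindexAlgEquiv F A e).symm N, fun i j => ?_,
      (Matrix.reindexAlgEquiv F A e).apply_symm_apply N⟩
    have := hN (e i) (e j)
    rwa [he, he] at this

/-- For `G`-graded algebras `A`, `B` over `F` and nonzero multisets `x`, `y`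
in `G`, there is an isomorphism of `G`-graded algebras
`M_x(A) ⊗ M_y(B) ≅ M_{xy}(A ⊗ B)`. -/
theorem matrix_tensor_graded_iso {F : Type} [Field F] {G : Type} [CommGroup G] [DecidableEq G]
    {A B : Type} [Ring A] [Algebra F A] [Ring B] [Algebra F B]
    (𝒜 : G → Submodule F A) (ℬ : G → Submodule F B)
    (h𝒜 : IsGrading F 𝒜) (hℬ : IsGrading F ℬ)
    {x y : Multiset G} (hx : x ≠ 0) (hy : y ≠ 0)
    {n m k : ℕ} (γ : Fin n → G) (δ : Fin m → G) (ε : Fin k → G)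
    (hγ : Reps γ x) (hδ : Reps δ y) (hε : Reps ε (mmul x y)) :
    IsGradedAlgIso F
      (tensorGrading F (matrixGrading γ 𝒜) (matrixGrading δ ℬ))
      (matrixGrading ε (tensorGrading F 𝒜 ℬ)) := by
  obtain ⟨e, he⟩ := exists_equiv_of_map_univ_eq
    (f := fun p : Fin n × Fin m => γ p.1 * δ p.2) (g := ε) (by
      rw [← mmul_map_univ, hγ, hδ, hε])
  refine ⟨(Matrix.kroneckerTMulAlgEquiv (Fin n) (Fin m) F F A B).trans
    (Matrix.reindexAlgEquiv F (A ⊗[F] B) e), fun g => ?_⟩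
  rw [← map_reindexAlgEquiv_matrixGrading _ e he, ← map_kroneckerTMulAlgEquiv_tensorGrading,
    ← Submodule.map_comp]
  rfl
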